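/- Let x_1 < \dots < x_n be n distinct real nodes, let D be an exact differentiation matrix for these nodes, and let K = Σ_{j=1}^m c_j·D^j for real constants c_1,…,c_m with m ≥ 1 (a discrete operator representing a strictly differential operator with no zeroth-order term). Then K is nilpotent with K^n = 0. -/

import Mathlib

open Polynomial Matrix

/-- Evaluation map `Φ : ℝ[X] → ℝⁿ`, `Φ(p) = (p(x₁), …, p(xₙ))`. -/
noncomputable def Phi {n : ℕ} (x : Fin n → ℝ) (p : ℝ[X]) : Fin n → ℝ :=
  fun i => p.eval (x i)

/-- Every vector of nodal values is attained by a polynomial of degree less than `n`. -/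
lemma exists_degree_lt_Phi_eq {n : ℕ} {x : Fin n → ℝ} (hx : Function.Injective x)
    (v : Fin n → ℝ) : ∃ p : ℝ[X], p.degree < n ∧ Phi x p = v := by
  refine ⟨Lagrange.interpolate Finset.univ x v, ?_, ?_⟩
  · simpa using Lagrange.degree_interpolate_lt (s := Finset.univ) v hx.injOn
  · ext i
    exact Lagrange.eval_interpolate_at_node v hx.injOn (Finset.mem_univ i)

lemma pow_mulVec_Phi {n : ℕ} {x : Fin n → ℝ} {D : Matrix (Fin n) (Fin n) ℝ}
    (hD : ∀ p : ℝ[X], p.degree < n → D.mulVec (Phi x p) = Phi x (derivative p))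
    (k : ℕ) {p : ℝ[X]} (hp : p.degree < n) :
    (D ^ k).mulVec (Phi x p) = Phi x (derivative^[k] p) := by
  induction k generalizing p with
  | zero => simp
  | succ k ih =>
    rw [pow_succ, ← Matrix.mulVec_mulVec, hD p hp, ih ((degree_derivative_le).trans_lt hp),
      Function.iterate_succ_apply]

/-- An exact differentiation matrix for `n` distinct nodes satisfies `Dⁿ = 0`. -/
lemma pow_eq_zero_of_exact_differentiation {n : ℕ} {x : Fin n → ℝ}
    (hx : Function.Injective x) {D : Matrix (Fin n) (Fin n) ℝ}
    (hD : ∀ p : ℝ[X], p.degree < n → D.mulVec (Phi x p) = Phi x (derivative p)) :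
    D ^ n = 0 := by
  refine Matrix.ext_of_mulVec_single fun i => ?_
  obtain ⟨p, hp, hv⟩ := exists_degree_lt_Phi_eq hx (Pi.single i 1)
  have hn : p.natDegree < n := by
    rcases eq_or_ne p 0 with rfl | h0
    · simpa using i.pos
    · exact (natDegree_lt_iff_degree_lt h0).2 hp
  rw [← hv, pow_mulVec_Phi hD n hp, iterate_derivative_eq_zero hn, Matrix.zero_mulVec]
  ext j
  simp [Phi]

/-- **Theorem (Nilpotency of strictly differential discrete operators).**
Let `D` be an exact differentiation matrix for strictly increasing nodes `x₁ < … < xₙ`,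
and let `K = Σ_{j=1}^m c_j·Dʲ` (`m ≥ 1`, real constants `c₁, …, c_m`) be the discrete
operator representing a strictly differential operator with no zeroth-order term.
Then `K` is nilpotent with `Kⁿ = 0`. -/
theorem strictly_differential_nilpotent {n : ℕ} (x : Fin n → ℝ) (hx : StrictMono x)
    (D : Matrix (Fin n) (Fin n) ℝ)
    (hD : ∀ p : ℝ[X], p.degree < n → D.mulVec (Phi x p) = Phi x (derivative p))
    (m : ℕ) (hm : 1 ≤ m) (c : ℕ → ℝ)
    (K : Matrix (Fin n) (Fin n) ℝ)
    (hK : K = ∑ j ∈ Finset.Icc 1 m, c j • D ^ j) :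
    K ^ n = 0 := by
  have hfac : K = D * ∑ j ∈ Finset.Icc 1 m, c j • D ^ (j - 1) := by
    rw [hK, Finset.mul_sum]
    refine Finset.sum_congr rfl fun j hj => ?_
    rw [mul_smul_comm, mul_pow_sub_one (Nat.one_le_iff_ne_zero.1 (Finset.mem_Icc.1 hj).1)]
  have hcomm : Commute D (∑ j ∈ Finset.Icc 1 m, c j • D ^ (j - 1)) :=
    Commute.sum_right _ _ _ fun j _ => ((Commute.refl D).pow_right _).smul_right _
  rw [hfac, hcomm.mul_pow, pow_eq_zero_of_exact_differentiation hx.injective hD, zero_mul]
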